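/- arXiv:2510.05455 — 10 statements merged into one kernel-verified Lean document; each statement's English description precedes it below -/
import Mathlib

section
/- Let V : ℝ → ℝ be a differentiable function with V(t) ≥ 0 for all t ≥ 0, and suppose there exist c > 0 and α ∈ (0,1) such that V'(t) ≤ -c · V(t)^α for all t ≥ 0. Then V(t) = 0 for all t ≥ V(0)^{1-α} / (c(1-α)). -/
/-- Finite-time stability comparison lemma (Lemma 2): a nonnegative differentiable
scalar function satisfying `V' ≤ -c V^α` with `α ∈ (0,1)` reaches zero by the
settling time `V(0)^(1-α) / (c (1-α))` and remains at zero afterwards. -/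
theorem finite_time_stability_comparison
    (V : ℝ → ℝ) (hV : Differentiable ℝ V)
    (hnn : ∀ t, 0 ≤ t → 0 ≤ V t)
    (c α : ℝ) (hc : 0 < c) (hα0 : 0 < α) (hα1 : α < 1)
    (hdecay : ∀ t, 0 ≤ t → deriv V t ≤ -c * V t ^ α) :
    ∀ t, V 0 ^ (1 - α) / (c * (1 - α)) ≤ t → V t = 0 := by
  intro t ht
  have hα : 0 < 1 - α := sub_pos.2 hα1
  have hk : 0 < c * (1 - α) := mul_pos hc hα
  have ht0 : 0 ≤ t := (div_nonneg (Real.rpow_nonneg (hnn 0 le_rfl) _) hk.le).trans ht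
  by_contra hne
  have hpos : 0 < V t := (hnn t ht0).lt_of_ne' hne
  have hanti : AntitoneOn V (Set.Ici 0) := by
    refine antitoneOn_of_deriv_nonpos (convex_Ici 0) hV.continuous.continuousOn
      hV.differentiableOn fun s hs => ?_
    have hs0 : 0 ≤ s := interior_subset hs
    have := mul_nonneg hc.le (Real.rpow_nonneg (hnn s hs0) α)
    linarith [hdecay s hs0]
  have hVpos : ∀ s ∈ Set.Icc 0 t, 0 < V s := fun s hs =>
    hpos.trans_le (hanti hs.1 ht0 hs.2)
  have hderiv : ∀ s ∈ Set.Icc 0 t, HasDerivAt (fun s => V s ^ (1 - α))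
      (deriv V s * (1 - α) * V s ^ (1 - α - 1)) s := fun s hs =>
    (hV s).hasDerivAt.rpow_const (Or.inl (hVpos s hs).ne')
  have hbound : V t ^ (1 - α) - V 0 ^ (1 - α) ≤ -(c * (1 - α)) * (t - 0) := by
    refine (convex_Icc 0 t).image_sub_le_mul_sub_of_deriv_le
      (f := fun s => V s ^ (1 - α))
      (fun s hs => (hderiv s hs).continuousAt.continuousWithinAt)
      (fun s hs => (hderiv s (interior_subset hs)).differentiableAt.differentiableWithinAt)
      (fun s hs => ?_) 0 (Set.left_mem_Icc.2 ht0) t (Set.right_mem_Icc.2 ht0) ht0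
    have hs' : s ∈ Set.Icc 0 t := interior_subset hs
    have hmul : V s ^ α * V s ^ (1 - α - 1) = 1 := by
      rw [← Real.rpow_add (hVpos s hs')]
      simp
    rw [(hderiv s hs').deriv]
    calc deriv V s * (1 - α) * V s ^ (1 - α - 1)
        ≤ -c * V s ^ α * (1 - α) * V s ^ (1 - α - 1) :=
          mul_le_mul_of_nonneg_right
            (mul_le_mul_of_nonneg_right (hdecay s hs'.1) hα.le)
            (Real.rpow_nonneg (hVpos s hs').le _)
      _ = -(c * (1 - α)) := by linear_combination -(c * (1 - α)) * hmul
  have hsettle := (div_le_iff₀ hk).1 ht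
  have := Real.rpow_pos_of_pos hpos (1 - α)
  linarith
end

section
/- Let V : ℝ → ℝ be a differentiable function with V(t) ≥ 0 for all t ≥ 0, and suppose there exist c₁, c₂ > 0, α ∈ (0,1), and β > 1 such that V'(t) ≤ -c₁ V(t)^α - c₂ V(t)^β for all t ≥ 0. Then V(t) = 0 for all t ≥ 1/(c₁(1-α)) + 1/(c₂(β-1)); in particular the settling time is bounded uniformly in the initial condition V(0). -/
/-- A positive function with `V' ≤ -c V ^ p`, `p ≠ 1`, on an interval loses at least
`c` times the elapsed time in the coordinate `V ^ (1 - p) / (1 - p)`. -/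
theorem rpow_div_sub_le_of_deriv_le_neg_mul_rpow {V : ℝ → ℝ} {a b c p : ℝ}
    (hV : Differentiable ℝ V) (hab : a ≤ b) (hp : p ≠ 1)
    (hpos : ∀ t ∈ Set.Icc a b, 0 < V t)
    (hdecay : ∀ t ∈ Set.Icc a b, deriv V t ≤ -c * V t ^ p) :
    V b ^ (1 - p) / (1 - p) - V a ^ (1 - p) / (1 - p) ≤ -c * (b - a) := by
  have hp' : 1 - p ≠ 0 := sub_ne_zero.mpr hp.symm
  have hderiv : ∀ t ∈ Set.Icc a b,
      HasDerivAt (fun t => V t ^ (1 - p) / (1 - p)) (deriv V t * V t ^ (-p)) t := by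
    intro t ht
    have h := ((hV t).hasDerivAt.rpow_const (p := 1 - p)
      (Or.inl (hpos t ht).ne')).div_const (1 - p)
    have heq : deriv V t * (1 - p) * V t ^ (1 - p - 1) / (1 - p) = deriv V t * V t ^ (-p) := by
      rw [show 1 - p - 1 = -p by ring]
      field_simp
    exact heq ▸ h
  refine (convex_Icc a b).image_sub_le_mul_sub_of_deriv_le
    (fun t ht => (hderiv t ht).continuousAt.continuousWithinAt)
    (fun t ht => (hderiv t (interior_subset ht)).differentiableAt.differentiableWithinAt)
    (fun t ht => ?_) a (Set.left_mem_Icc.mpr hab) b (Set.right_mem_Icc.mpr hab) hab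
  have ht' := interior_subset ht
  have hVt := hpos t ht'
  rw [(hderiv t ht').deriv]
  calc deriv V t * V t ^ (-p) ≤ -c * V t ^ p * V t ^ (-p) :=
        mul_le_mul_of_nonneg_right (hdecay t ht') (Real.rpow_nonneg hVt.le _)
    _ = -c := by rw [mul_assoc, ← Real.rpow_add hVt, add_neg_cancel, Real.rpow_zero, mul_one]

/-- Fixed-time stability comparison lemma (Lemma 3): a nonnegative differentiable
scalar function satisfying `V' ≤ -c₁ V^α - c₂ V^β` with `0 < α < 1 < β` reaches zero
within the uniform time bound `1/(c₁(1-α)) + 1/(c₂(β-1))`, independent of `V(0)`. -/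
theorem fixed_time_stability_comparison
    (V : ℝ → ℝ) (hV : Differentiable ℝ V)
    (hnn : ∀ t, 0 ≤ t → 0 ≤ V t)
    (c₁ c₂ α β : ℝ) (hc₁ : 0 < c₁) (hc₂ : 0 < c₂)
    (hα0 : 0 < α) (hα1 : α < 1) (hβ : 1 < β)
    (hdecay : ∀ t, 0 ≤ t → deriv V t ≤ -c₁ * V t ^ α - c₂ * V t ^ β) :
    ∀ t, 1 / (c₁ * (1 - α)) + 1 / (c₂ * (β - 1)) ≤ t → V t = 0 := by
  intro T hT
  have hα : 0 < 1 - α := sub_pos.mpr hα1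
  have hβ' : 0 < β - 1 := sub_pos.mpr hβ
  set T₁ := 1 / (c₁ * (1 - α)) with hT₁
  set T₂ := 1 / (c₂ * (β - 1)) with hT₂
  have hT₁pos : 0 < T₁ := by positivity
  have hT₂pos : 0 < T₂ := by positivity
  have hanti : AntitoneOn V (Set.Ici 0) := by
    refine antitoneOn_of_deriv_nonpos (convex_Ici 0) hV.continuous.continuousOn
      hV.differentiableOn fun t ht => ?_
    have ht' : 0 ≤ t := interior_subset ht
    have h₁ := mul_nonneg hc₁.le (Real.rpow_nonneg (hnn t ht') α)
    have h₂ := mul_nonneg hc₂.le (Real.rpow_nonneg (hnn t ht') β)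
    linarith [hdecay t ht']
  by_contra hne
  have hT0 : 0 ≤ T := by linarith
  have hVT : 0 < V T := lt_of_le_of_ne (hnn T hT0) (Ne.symm hne)
  have hpos : ∀ t, 0 ≤ t → t ≤ T → 0 < V t := fun t h0 h =>
    hVT.trans_le (hanti h0 hT0 h)
  have hV₂ : V T₂ < 1 := by
    have h := rpow_div_sub_le_of_deriv_le_neg_mul_rpow (c := c₂) hV hT₂pos.le hβ.ne'
      (fun t ht => hpos t ht.1 (by linarith [ht.2])) fun t ht => by
        have := mul_nonneg hc₁.le (Real.rpow_nonneg (hnn t ht.1) α)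
        linarith [hdecay t ht.1]
    have hV0 := Real.rpow_pos_of_pos (hpos 0 le_rfl hT0) (1 - β)
    have hone : c₂ * T₂ * (β - 1) = 1 := by rw [hT₂]; field_simp
    rw [← sub_div, div_le_iff_of_neg (by linarith)] at h
    by_contra! hge
    have := Real.rpow_le_one_of_one_le_of_nonpos hge (show 1 - β ≤ 0 by linarith)
    linarith
  have hT₂T : T₂ ≤ T := by linarith
  have h := rpow_div_sub_le_of_deriv_le_neg_mul_rpow (c := c₁) hV hT₂T hα1.ne
    (fun t ht => hpos t (hT₂pos.le.trans ht.1) ht.2) fun t ht => by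
      have ht0 := hT₂pos.le.trans ht.1
      have := mul_nonneg hc₂.le (Real.rpow_nonneg (hnn t ht0) β)
      linarith [hdecay t ht0]
  have hlt := Real.rpow_lt_one (hnn T₂ hT₂pos.le) hV₂ hα
  have hVTα := Real.rpow_pos_of_pos hVT (1 - α)
  have hone : c₁ * (1 - α) * T₁ = 1 := by rw [hT₁]; field_simp
  have hmul : c₁ * (1 - α) * T₁ ≤ c₁ * (1 - α) * (T - T₂) :=
    mul_le_mul_of_nonneg_left (by linarith) (by positivity)
  rw [← sub_div, div_le_iff₀ hα] at h
  linarith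
end

section
/- Let T > 0 and c > 0, and let V : [0,T) → ℝ be a differentiable function with V(t) ≥ 0 for all t ∈ [0,T), satisfying V'(t) ≤ -c · (T/(T-t)) · V(t) for all t ∈ [0,T). Then V(t) ≤ V(0) · ((T-t)/T)^{cT} for all t ∈ [0,T); in particular V(t) → 0 as t → T⁻, independently of the initial condition V(0). -/
/-- If `V' ≤ -c (T/(T-t)) V` on `[0,T)`, then `V(t) (T-t)^(-cT)` is nonincreasing there. -/
theorem antitoneOn_mul_sub_rpow_of_deriv_le {T c : ℝ} {V : ℝ → ℝ}
    (hV : ∀ t, 0 ≤ t → t < T → DifferentiableAt ℝ V t)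
    (hdecay : ∀ t, 0 ≤ t → t < T → deriv V t ≤ -c * (T / (T - t)) * V t) :
    AntitoneOn (fun t => V t * (T - t) ^ (-(c * T))) (Set.Ico 0 T) := by
  have hderiv : ∀ t ∈ Set.Ico 0 T, HasDerivAt (fun t => V t * (T - t) ^ (-(c * T)))
      (deriv V t * (T - t) ^ (-(c * T)) +
        V t * (-1 * -(c * T) * (T - t) ^ (-(c * T) - 1))) t := fun t ht =>
    (hV t ht.1 ht.2).hasDerivAt.mul
      (((hasDerivAt_id t).const_sub T).rpow_const (Or.inl (sub_pos.2 ht.2).ne'))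
  refine antitoneOn_of_deriv_nonpos (convex_Ico 0 T)
    (fun t ht => (hderiv t ht).continuousAt.continuousWithinAt)
    (fun t ht => (hderiv t (interior_subset ht)).differentiableAt.differentiableWithinAt)
    fun t ht => ?_
  have ht' := interior_subset ht
  have hpos : 0 < T - t := sub_pos.2 ht'.2
  rw [(hderiv t ht').deriv, Real.rpow_sub_one hpos.ne']
  have h := mul_le_mul_of_nonneg_right (hdecay t ht'.1 ht'.2)
    (Real.rpow_nonneg hpos.le (-(c * T)))
  calc _ ≤ -c * (T / (T - t)) * V t * (T - t) ^ (-(c * T)) +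
        V t * (-1 * -(c * T) * ((T - t) ^ (-(c * T)) / (T - t))) := by gcongr
    _ = 0 := by ring

/-- Prescribed-time stability comparison lemma (Lemma 4): a nonnegative scalar
function on `[0,T)` satisfying `V' ≤ -c (T/(T-t)) V` obeys
`V(t) ≤ V(0) ((T-t)/T)^(cT)` and hence converges to zero as `t → T⁻`,
independently of the initial condition. -/
theorem prescribed_time_stability_comparison
    (T c : ℝ) (hT : 0 < T) (hc : 0 < c)
    (V : ℝ → ℝ)
    (hV : ∀ t, 0 ≤ t → t < T → DifferentiableAt ℝ V t)
    (hnn : ∀ t, 0 ≤ t → t < T → 0 ≤ V t)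
    (hdecay : ∀ t, 0 ≤ t → t < T → deriv V t ≤ -c * (T / (T - t)) * V t) :
    (∀ t, 0 ≤ t → t < T → V t ≤ V 0 * ((T - t) / T) ^ (c * T)) ∧
      Filter.Tendsto V (nhdsWithin T (Set.Iio T)) (nhds 0) := by
  have hbound : ∀ t, 0 ≤ t → t < T → V t ≤ V 0 * ((T - t) / T) ^ (c * T) := by
    intro t h0 ht
    have hpos : 0 < T - t := sub_pos.2 ht
    have h := antitoneOn_mul_sub_rpow_of_deriv_le hV hdecay ⟨le_rfl, hT⟩ ⟨h0, ht⟩ h0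
    simp only [sub_zero, Real.rpow_neg hpos.le, Real.rpow_neg hT.le, ← div_eq_mul_inv] at h
    rw [div_le_iff₀ (Real.rpow_pos_of_pos hpos _)] at h
    rwa [Real.div_rpow hpos.le hT.le, ← mul_div_assoc, mul_div_right_comm]
  refine ⟨hbound, ?_⟩
  have hlim : Filter.Tendsto (fun t => V 0 * ((T - t) / T) ^ (c * T))
      (nhdsWithin T (Set.Iio T)) (nhds 0) := by
    have hcont : Continuous fun t => V 0 * ((T - t) / T) ^ (c * T) :=
      continuous_const.mul
        (((continuous_const.sub continuous_id).div_const T).rpow_const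
          fun _ => Or.inr (mul_pos hc hT).le)
    have h := hcont.tendsto T
    simp only [sub_self, zero_div, Real.zero_rpow (mul_pos hc hT).ne', mul_zero] at h
    exact h.mono_left nhdsWithin_le_nhds
  have hmem : ∀ᶠ t in nhdsWithin T (Set.Iio T), t ∈ Set.Ico 0 T := Ico_mem_nhdsLT hT
  exact tendsto_of_tendsto_of_tendsto_of_le_of_le' tendsto_const_nhds hlim
    (hmem.mono fun t ht => hnn t ht.1 ht.2) (hmem.mono fun t ht => hbound t ht.1 ht.2)
end

section
/- Let S : ℝⁿ → ℝⁿ be differentiable, define V(z) = ½‖S(z)‖², and let λ : ℝ × ℝ → ℝ. Let z : ℝ → ℝⁿ be a differentiable trajectory such that for every t ≥ 0 the Fréchet derivative DS(z(t)) is an invertible linear map and z'(t) = -λ(V(z(t)), t) · (DS(z(t)))⁻¹ S(z(t)). Then for every t ≥ 0, (d/dt) V(z(t)) = -2 λ(V(z(t)), t) · V(z(t)). -/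
/-- Newton dynamics (ND) feedback design (Lemma 6): with `V(z) = ½‖S(z)‖²` and the
Newton-type feedback `ż = -λ(V(z),t) (DS(z))⁻¹ S(z)`, where the Fréchet derivative
`DS(z(t))` is invertible along the trajectory, the exact decay identity
`V̇ = -2 λ V` holds. -/
theorem newton_dynamics_decay
    (n : ℕ) (S : EuclideanSpace ℝ (Fin n) → EuclideanSpace ℝ (Fin n))
    (hS : Differentiable ℝ S)
    (V : EuclideanSpace ℝ (Fin n) → ℝ)
    (hV : ∀ w, V w = (1 / 2) * ‖S w‖ ^ 2)
    (lam : ℝ → ℝ → ℝ)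
    (z : ℝ → EuclideanSpace ℝ (Fin n)) (hz : Differentiable ℝ z)
    (hdyn : ∀ t, 0 ≤ t →
      ∃ A : EuclideanSpace ℝ (Fin n) ≃L[ℝ] EuclideanSpace ℝ (Fin n),
        (A : EuclideanSpace ℝ (Fin n) →L[ℝ] EuclideanSpace ℝ (Fin n)) = fderiv ℝ S (z t) ∧
        deriv z t = (-(lam (V (z t)) t)) • A.symm (S (z t))) :
    ∀ t, 0 ≤ t → deriv (fun s => V (z s)) t = -2 * lam (V (z t)) t * V (z t) := by
  intro t ht
  obtain ⟨A, hA, hdz⟩ := hdyn t ht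
  have hSz : HasDerivAt (fun s => S (z s)) ((-(lam (V (z t)) t)) • S (z t)) t := by
    have h := (hS (z t)).hasFDerivAt.comp_hasDerivAt t (hz t).hasDerivAt
    rw [hdz, ← hA, map_smul, ContinuousLinearEquiv.coe_coe, A.apply_symm_apply] at h
    exact h
  have hVz := hSz.norm_sq.const_mul (1 / 2 : ℝ)
  simp only [← hV] at hVz
  rw [hVz.deriv, real_inner_smul_right, real_inner_self_eq_norm_sq]
  linear_combination 2 * lam (V (z t)) t * hV (z t)
end

section
/- Let S : ℝⁿ → ℝⁿ be differentiable and suppose there exists m > 0 such that for every z ∈ ℝⁿ and every x ∈ ℝⁿ, ⟨x, DS(z) x⟩ ≥ m‖x‖² (i.e., the symmetric part of the Jacobian of S is uniformly bounded below by mI). Define V(z) = ½‖S(z)‖², let γ : ℝ × ℝ → ℝ be nonnegative, and let z : ℝ → ℝⁿ be a differentiable trajectory with z'(t) = -γ(V(z(t)), t) · S(z(t)) for all t ≥ 0. Then for every t ≥ 0, (d/dt) V(z(t)) ≤ -2 m γ(V(z(t)), t) · V(z(t)). -/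
open RealInnerProductSpace

/-- Gradient dynamics (GD) feedback design (Lemma 7): if the symmetric part of the
Jacobian of `S` is uniformly bounded below by `m I` (i.e. `⟪x, DS(z) x⟫ ≥ m ‖x‖²`),
then the feedback `ż = -γ(V(z),t) S(z)` with `V(z) = ½‖S(z)‖²` yields
`V̇ ≤ -2 m γ V`. -/
theorem gradient_dynamics_decay
    (n : ℕ) (S : EuclideanSpace ℝ (Fin n) → EuclideanSpace ℝ (Fin n))
    (hS : Differentiable ℝ S)
    (m : ℝ) (hm : 0 < m)
    (hmono : ∀ z x : EuclideanSpace ℝ (Fin n), m * ‖x‖ ^ 2 ≤ ⟪x, fderiv ℝ S z x⟫)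
    (V : EuclideanSpace ℝ (Fin n) → ℝ)
    (hV : ∀ w, V w = (1 / 2) * ‖S w‖ ^ 2)
    (γ : ℝ → ℝ → ℝ) (hγ : ∀ a b, 0 ≤ γ a b)
    (z : ℝ → EuclideanSpace ℝ (Fin n)) (hz : Differentiable ℝ z)
    (hdyn : ∀ t, 0 ≤ t → deriv z t = (-(γ (V (z t)) t)) • S (z t)) :
    ∀ t, 0 ≤ t →
      deriv (fun s => V (z s)) t ≤ -2 * m * γ (V (z t)) t * V (z t) := by
  intro t ht
  have hSz : HasDerivAt (fun s => S (z s)) (fderiv ℝ S (z t) (deriv z t)) t :=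
    (hS (z t)).hasFDerivAt.comp_hasDerivAt t (hz t).hasDerivAt
  have hVz : HasDerivAt (fun s => V (z s))
      ((1 / 2) * (2 * inner ℝ (S (z t)) (fderiv ℝ S (z t) (deriv z t)))) t := by
    simp only [hV]
    exact hSz.norm_sq.const_mul _
  rw [hVz.deriv, hdyn t ht, map_smul, real_inner_smul_right]
  have hbound := mul_le_mul_of_nonneg_left (hmono (z t) (S (z t))) (hγ (V (z t)) t)
  have hVt := hV (z t)
  generalize γ (V (z t)) t = g at *
  rw [hVt]
  linarith
end

section
/- Let J : ℝⁿ → ℝ be twice continuously differentiable, define w(x) = ∇²J(x) · ∇J(x) (the Hessian applied to the gradient) and V(x) = ½‖∇J(x)‖², and let σ : ℝ × ℝ → ℝ. Let x : ℝ → ℝⁿ be a differentiable trajectory such that for every t ≥ 0, w(x(t)) ≠ 0 and x'(t) = -(σ(V(x(t)), t) / ‖w(x(t))‖²) · w(x(t)). Then for every t ≥ 0, (d/dt) V(x(t)) = -σ(V(x(t)), t). -/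
open InnerProductSpace in
/-- The gradient of a `C²` function on a real Hilbert space is differentiable. -/
theorem ContDiff.differentiable_gradient {F : Type*} [NormedAddCommGroup F]
    [InnerProductSpace ℝ F] [CompleteSpace F] {f : F → ℝ} (hf : ContDiff ℝ 2 f) :
    Differentiable ℝ (gradient f) := by
  have hdual : IsBoundedLinearMap ℝ (toDual ℝ F).symm :=
    { map_add := map_add _
      map_smul := fun c v => by simp
      bound := ⟨1, one_pos, fun v => by simp⟩ }
  have hfd : Differentiable ℝ (fderiv ℝ f) :=
    (hf.fderiv_right (m := 1) (by norm_num)).differentiable (by norm_num)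
  exact hdual.differentiable.comp hfd

/-- The derivative of the gradient represents the second derivative. -/
theorem inner_fderiv_gradient {F : Type*} [NormedAddCommGroup F]
    [InnerProductSpace ℝ F] [CompleteSpace F] {f : F → ℝ} (hf : ContDiff ℝ 2 f) (y u v : F) :
    inner ℝ (fderiv ℝ (gradient f) y u) v = fderiv ℝ (fderiv ℝ f) y u v := by
  have hfd : Differentiable ℝ (fderiv ℝ f) :=
    (hf.fderiv_right (m := 1) (by norm_num)).differentiable (by norm_num)
  have heq : (fun z => inner ℝ (gradient f z) v) = fun z => fderiv ℝ f z v := by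
    funext z
    exact inner_gradient_left
  have hleft := (hf.differentiable_gradient y).hasFDerivAt.inner ℝ (hasFDerivAt_const v y)
  have hright := (hfd y).hasFDerivAt.clm_apply (hasFDerivAt_const v y)
  rw [heq] at hleft
  simpa using DFunLike.congr_fun (hleft.unique hright) u

/-- The Hessian of a `C²` function is self-adjoint. -/
theorem inner_fderiv_gradient_comm {F : Type*} [NormedAddCommGroup F]
    [InnerProductSpace ℝ F] [CompleteSpace F] {f : F → ℝ} (hf : ContDiff ℝ 2 f) (y u v : F) :
    inner ℝ (fderiv ℝ (gradient f) y u) v = inner ℝ u (fderiv ℝ (gradient f) y v) := by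
  have hsymm : IsSymmSndFDerivAt ℝ f y := hf.contDiffAt.isSymmSndFDerivAt (by simp)
  rw [real_inner_comm _ u, inner_fderiv_gradient hf, inner_fderiv_gradient hf, hsymm.eq]


/-- Hessian-gradient dynamics for unconstrained optimization (Example 2): with
`w(x) = ∇²J(x) ∇J(x)` (the Hessian applied to the gradient) and
`V(x) = ½‖∇J(x)‖²`, the feedback `ẋ = -(σ(V(x),t)/‖w(x)‖²) w(x)` enforces
`V̇ = -σ(V,t)` with equality, provided `w(x(t)) ≠ 0` along the trajectory. -/
theorem hgd_unconstrained
    (n : ℕ) (J : EuclideanSpace ℝ (Fin n) → ℝ) (hJ : ContDiff ℝ 2 J)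
    (w : EuclideanSpace ℝ (Fin n) → EuclideanSpace ℝ (Fin n))
    (hw : ∀ y, w y = fderiv ℝ (fun v => gradient J v) y (gradient J y))
    (V : EuclideanSpace ℝ (Fin n) → ℝ)
    (hV : ∀ y, V y = (1 / 2) * ‖gradient J y‖ ^ 2)
    (σ : ℝ → ℝ → ℝ)
    (x : ℝ → EuclideanSpace ℝ (Fin n)) (hx : Differentiable ℝ x)
    (hne : ∀ t, 0 ≤ t → w (x t) ≠ 0)
    (hdyn : ∀ t, 0 ≤ t → deriv x t = (-(σ (V (x t)) t / ‖w (x t)‖ ^ 2)) • w (x t)) :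
    ∀ t, 0 ≤ t → deriv (fun s => V (x s)) t = -σ (V (x t)) t := by
  intro t ht
  have hgrad : HasDerivAt (fun s => gradient J (x s))
      (fderiv ℝ (gradient J) (x t) (deriv x t)) t :=
    (hJ.differentiable_gradient (x t)).hasFDerivAt.comp_hasDerivAt t (hx t).hasDerivAt
  have hVx : HasDerivAt (fun s => V (x s)) (inner ℝ (w (x t)) (deriv x t)) t := by
    have hval : inner ℝ (w (x t)) (deriv x t) = 1 / 2 *
        (2 * inner ℝ (gradient J (x t)) (fderiv ℝ (gradient J) (x t) (deriv x t))) := by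
      rw [hw, inner_fderiv_gradient_comm hJ]
      ring
    rw [hval, funext fun s => hV (x s)]
    exact hgrad.norm_sq.const_mul (1 / 2)
  rw [hVx.deriv, hdyn t ht, inner_smul_right, real_inner_self_eq_norm_sq]
  have hnorm : ‖w (x t)‖ ≠ 0 := norm_ne_zero_iff.mpr (hne t ht)
  field_simp
end

section
/- Let V : ℝⁿ → ℝ be continuously differentiable and nonnegative, let c > 0, and let z : ℝ → ℝⁿ be a differentiable trajectory such that for every t ≥ 0, ∇V(z(t)) ≠ 0 and z'(t) = -(c · V(z(t)) / ‖∇V(z(t))‖²) · ∇V(z(t)). Then V(z(t)) = V(z(0)) · exp(-c t) for all t ≥ 0. -/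
/-- The Hessian-gradient feedback with selector value `σ` makes `V` decrease at rate `σ`
along the trajectory. -/
theorem HasDerivAt.comp_of_gradient_feedback
    {E : Type*} [NormedAddCommGroup E] [InnerProductSpace ℝ E] [CompleteSpace E]
    {V : E → ℝ} {z : ℝ → E} {t σ : ℝ} (hV : DifferentiableAt ℝ V (z t))
    (hgrad : gradient V (z t) ≠ 0)
    (hz : HasDerivAt z ((-(σ / ‖gradient V (z t)‖ ^ 2)) • gradient V (z t)) t) :
    HasDerivAt (fun s => V (z s)) (-σ) t := by
  have h := hV.hasGradientAt.hasFDerivAt.comp_hasDerivAt t hz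
  have hnorm : ‖gradient V (z t)‖ ^ 2 ≠ 0 := pow_ne_zero 2 (norm_ne_zero_iff.mpr hgrad)
  refine h.congr_deriv ?_
  rw [InnerProductSpace.toDual_apply_apply, real_inner_smul_right, real_inner_self_eq_norm_sq]
  field_simp

/-- Solutions of `f' = -c f` on `[0, ∞)` are exponentials. -/
theorem eq_mul_exp_of_hasDerivAt_neg_mul {f : ℝ → ℝ} {c : ℝ}
    (hf : ∀ t, 0 ≤ t → HasDerivAt f (-(c * f t)) t) {t : ℝ} (ht : 0 ≤ t) :
    f t = f 0 * Real.exp (-c * t) := by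
  have hderiv : ∀ s, 0 ≤ s → HasDerivAt (fun s => f s * Real.exp (c * s)) 0 s := by
    intro s hs
    refine ((hf s hs).mul ((hasDerivAt_id s).const_mul c).exp).congr_deriv ?_
    simp only [id_eq]
    ring
  have hconst := constant_of_has_deriv_right_zero
    (fun s hs => (hderiv s hs.1).continuousAt.continuousWithinAt)
    (fun s hs => (hderiv s hs.1).hasDerivWithinAt) t (Set.right_mem_Icc.mpr ht)
  simp only [mul_zero, Real.exp_zero, mul_one] at hconst
  rw [← hconst, mul_assoc, ← Real.exp_add]
  simp

/-- HGD with the exponential law selector `σ(V,t) = c V`: the feedback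
`ż = -(c V(z)/‖∇V(z)‖²) ∇V(z)` under the nonsingularity condition yields exact
exponential decay `V(z(t)) = V(z(0)) e^{-c t}`. -/
theorem hgd_exponential_law
    (n : ℕ) (V : EuclideanSpace ℝ (Fin n) → ℝ) (hV : ContDiff ℝ 1 V)
    (hnn : ∀ y, 0 ≤ V y)
    (c : ℝ) (hc : 0 < c)
    (z : ℝ → EuclideanSpace ℝ (Fin n)) (hz : Differentiable ℝ z)
    (hgrad : ∀ t, 0 ≤ t → gradient V (z t) ≠ 0)
    (hdyn : ∀ t, 0 ≤ t → deriv z t =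
      (-(c * V (z t) / ‖gradient V (z t)‖ ^ 2)) • gradient V (z t)) :
    ∀ t, 0 ≤ t → V (z t) = V (z 0) * Real.exp (-c * t) := by
  intro t ht
  refine eq_mul_exp_of_hasDerivAt_neg_mul (f := fun s => V (z s)) (fun s hs => ?_) ht
  refine HasDerivAt.comp_of_gradient_feedback (hV.differentiable one_ne_zero _) (hgrad s hs) ?_
  rw [← hdyn s hs]
  exact (hz s).hasDerivAt
end

section
/- Let V : ℝⁿ → ℝ be continuously differentiable and nonnegative, let k > 0 and γ ∈ (0,1), and let z : ℝ → ℝⁿ be a differentiable trajectory such that at every t ≥ 0 with V(z(t)) > 0 we have ∇V(z(t)) ≠ 0 and z'(t) = -(k · V(z(t))^γ / ‖∇V(z(t))‖²) · ∇V(z(t)). Then V(z(t)) = 0 for all t ≥ V(z(0))^{1-γ} / (k(1-γ)). -/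
/-- Finite-time comparison lemma: a nonnegative function whose derivative is at most `-k f ^ γ`
wherever `f` is positive vanishes from the settling time on. -/
theorem eq_zero_of_deriv_le_neg_mul_rpow {f : ℝ → ℝ} {k γ : ℝ} (hf : Differentiable ℝ f)
    (hf0 : ∀ t, 0 ≤ f t) (hk : 0 < k) (hγ : γ < 1)
    (hderiv : ∀ t, 0 ≤ t → 0 < f t → deriv f t ≤ -(k * f t ^ γ))
    {t : ℝ} (ht : f 0 ^ (1 - γ) / (k * (1 - γ)) ≤ t) : f t = 0 := by
  have hγ' : 0 < 1 - γ := sub_pos.2 hγ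
  have hkγ : 0 < k * (1 - γ) := mul_pos hk hγ'
  have ht0 : 0 ≤ t := (div_nonneg (Real.rpow_nonneg (hf0 0) _) hkγ.le).trans ht
  have hanti : AntitoneOn f (Set.Ici 0) := by
    refine antitoneOn_of_deriv_nonpos (convex_Ici 0) hf.continuous.continuousOn
      hf.differentiableOn fun s hs => ?_
    rw [interior_Ici] at hs
    rcases (hf0 s).eq_or_lt with h | h
    · have hmin : IsLocalMin f s := Filter.Eventually.of_forall fun r => h ▸ hf0 r
      exact hmin.deriv_eq_zero.le
    · exact (hderiv s (le_of_lt hs) h).trans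
        (neg_nonpos.2 (mul_nonneg hk.le (Real.rpow_nonneg h.le _)))
  by_contra hne
  have hpos : 0 < f t := (hf0 t).lt_of_ne' hne
  have hpos' : ∀ s ∈ Set.Icc 0 t, 0 < f s := fun s hs =>
    hpos.trans_le (hanti hs.1 ht0 hs.2)
  have hg : ∀ s ∈ Set.Icc 0 t, HasDerivAt (fun s => f s ^ (1 - γ) + k * (1 - γ) * s)
      (deriv f s * (1 - γ) * f s ^ (1 - γ - 1) + k * (1 - γ) * 1) s := fun s hs =>
    ((hf s).hasDerivAt.rpow_const (Or.inl (hpos' s hs).ne')).add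
      ((hasDerivAt_id s).const_mul _)
  have hganti : AntitoneOn (fun s => f s ^ (1 - γ) + k * (1 - γ) * s) (Set.Icc 0 t) := by
    refine antitoneOn_of_deriv_nonpos (convex_Icc 0 t)
      (fun s hs => (hg s hs).continuousAt.continuousWithinAt)
      (fun s hs => (hg s (interior_subset hs)).differentiableAt.differentiableWithinAt)
      fun s hs => ?_
    have hs' := interior_subset hs
    have hfs := hpos' s hs'
    rw [(hg s hs').deriv]
    have hprod : f s ^ γ * f s ^ (1 - γ - 1) = 1 := by
      rw [← Real.rpow_add hfs, show γ + (1 - γ - 1) = 0 by ring, Real.rpow_zero]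
    have hle := mul_le_mul_of_nonneg_right (hderiv s hs'.1 hfs)
      (mul_nonneg hγ'.le (Real.rpow_nonneg hfs.le (1 - γ - 1)))
    linear_combination hle - k * (1 - γ) * hprod
  have hle := hganti (Set.left_mem_Icc.2 ht0) (Set.right_mem_Icc.2 ht0) ht0
  rw [div_le_iff₀ hkγ] at ht
  have hgt := Real.rpow_pos_of_pos hpos (1 - γ)
  simp only [mul_zero, add_zero] at hle
  linarith

/-- HGD with the finite-time law selector `σ(V,t) = k V^γ`, `0 < γ < 1`: the
feedback `ż = -(k V(z)^γ/‖∇V(z)‖²) ∇V(z)` (required wherever `V(z(t)) > 0`,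
with the nonsingularity condition `∇V ≠ 0` there) drives `V` to zero by the
settling time `V(z(0))^{1-γ}/(k(1-γ))`, and `V` stays at zero afterwards. -/
theorem hgd_finite_time_law
    (n : ℕ) (V : EuclideanSpace ℝ (Fin n) → ℝ) (hV : ContDiff ℝ 1 V)
    (hnn : ∀ y, 0 ≤ V y)
    (k γ : ℝ) (hk : 0 < k) (hγ0 : 0 < γ) (hγ1 : γ < 1)
    (z : ℝ → EuclideanSpace ℝ (Fin n)) (hz : Differentiable ℝ z)
    (hgrad : ∀ t, 0 ≤ t → 0 < V (z t) → gradient V (z t) ≠ 0)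
    (hdyn : ∀ t, 0 ≤ t → 0 < V (z t) → deriv z t =
      (-(k * V (z t) ^ γ / ‖gradient V (z t)‖ ^ 2)) • gradient V (z t)) :
    ∀ t, V (z 0) ^ (1 - γ) / (k * (1 - γ)) ≤ t → V (z t) = 0 := by
  have hVd : Differentiable ℝ V := hV.differentiable one_ne_zero
  intro t ht
  refine eq_zero_of_deriv_le_neg_mul_rpow (f := fun s => V (z s)) (hVd.comp hz)
    (fun s => hnn (z s)) hk hγ1 (fun s hs hpos => le_of_eq ?_) ht
  have hchain := (hVd (z s)).hasGradientAt.hasFDerivAt.comp_hasDerivAt s (hz s).hasDerivAt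
  have hnorm : ‖gradient V (z s)‖ ^ 2 ≠ 0 := pow_ne_zero 2 (norm_ne_zero_iff.2 (hgrad s hs hpos))
  refine hchain.deriv.trans ?_
  rw [InnerProductSpace.toDual_apply_apply, hdyn s hs hpos, real_inner_smul_right,
    real_inner_self_eq_norm_sq, neg_mul, div_mul_cancel₀ _ hnorm]
end

section
/- Let V : ℝⁿ → ℝ be continuously differentiable and nonnegative, let c₁, c₂ > 0, α ∈ (0,1), and β > 1, and let z : ℝ → ℝⁿ be a differentiable trajectory such that at every t ≥ 0 with V(z(t)) > 0 we have ∇V(z(t)) ≠ 0 and z'(t) = -((c₁ V(z(t))^α + c₂ V(z(t))^β) / ‖∇V(z(t))‖²) · ∇V(z(t)). Then V(z(t)) = 0 for all t ≥ 1/(c₁(1-α)) + 1/(c₂(β-1)), a bound independent of the initial condition z(0). -/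
/-- A differentiable nonnegative function whose derivative is nonpositive wherever the function is
positive is nonincreasing on `[0, ∞)`. -/
theorem antitoneOn_of_deriv_nonpos_of_pos {f : ℝ → ℝ} (hf : Differentiable ℝ f)
    (hnn : ∀ t, 0 ≤ f t) (hd : ∀ t, 0 ≤ t → 0 < f t → deriv f t ≤ 0) :
    AntitoneOn f (Set.Ici 0) := by
  refine antitoneOn_of_deriv_nonpos (convex_Ici 0) hf.continuous.continuousOn
    hf.differentiableOn fun t ht => ?_
  rw [interior_Ici] at ht
  rcases (hnn t).eq_or_lt with h | h
  · have hmin : IsLocalMin f t := Filter.Eventually.of_forall fun s => h ▸ hnn s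
    exact hmin.deriv_eq_zero.le
  · exact hd t (le_of_lt ht) h

/-- **Fixed-time comparison lemma**: if `f ≥ 0` satisfies `f' ≤ -(c₁ f^α + c₂ f^β)` wherever
`f > 0`, with `α < 1 < β`, then `f` vanishes from time `1/(c₁(1-α)) + 1/(c₂(β-1))` on. -/
theorem eq_zero_of_deriv_le_fixed_time {f : ℝ → ℝ} {c₁ c₂ α β : ℝ} (hf : Differentiable ℝ f)
    (hnn : ∀ t, 0 ≤ f t) (hc₁ : 0 < c₁) (hc₂ : 0 < c₂) (hα : α < 1) (hβ : 1 < β)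
    (hd : ∀ t, 0 ≤ t → 0 < f t → deriv f t ≤ -(c₁ * f t ^ α + c₂ * f t ^ β))
    {T : ℝ} (hT : 1 / (c₁ * (1 - α)) + 1 / (c₂ * (β - 1)) ≤ T) : f T = 0 := by
  have hα' : 0 < c₁ * (1 - α) := mul_pos hc₁ (sub_pos.2 hα)
  have hβ' : 0 < c₂ * (β - 1) := mul_pos hc₂ (sub_pos.2 hβ)
  set S := 1 / (c₂ * (β - 1))
  have hS0 : 0 < S := one_div_pos.2 hβ'
  have hST : S ≤ T := by linarith [one_div_pos.2 hα']
  by_contra hne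
  have hanti : AntitoneOn f (Set.Ici 0) :=
    antitoneOn_of_deriv_nonpos_of_pos hf hnn fun t ht h => (hd t ht h).trans <| by
      have := Real.rpow_pos_of_pos h α
      have := Real.rpow_pos_of_pos h β
      rw [neg_nonpos]
      positivity
  have hpos : ∀ t, 0 ≤ t → t ≤ T → 0 < f t := fun t ht htT =>
    ((hnn T).lt_of_ne' hne).trans_le (hanti ht (ht.trans htT) htT)
  have hder : ∀ p t, 0 ≤ t → t ≤ T →
      HasDerivAt (fun s => f s ^ p) (deriv f t * p * f t ^ (p - 1)) t := fun p t ht htT =>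
    (hf t).hasDerivAt.rpow_const (Or.inl (hpos t ht htT).ne')
  have hmul : ∀ (q t : ℝ), 0 ≤ t → t ≤ T → f t ^ q * f t ^ (-q) = 1 := fun q t ht htT => by
    rw [← Real.rpow_add (hpos t ht htT), add_neg_cancel, Real.rpow_zero]
  have hlarge : c₂ * (β - 1) * (S - 0) ≤ f S ^ (1 - β) - f 0 ^ (1 - β) := by
    refine (convex_Icc 0 T).mul_sub_le_image_sub_of_le_deriv (f := fun s => f s ^ (1 - β))
      (fun t ht => (hder _ t ht.1 ht.2).continuousAt.continuousWithinAt)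
      (fun t ht => (hder _ t (interior_subset ht).1
        (interior_subset ht).2).differentiableAt.differentiableWithinAt)
      (fun t ht => ?_) 0 ⟨le_rfl, hS0.le.trans hST⟩ S ⟨hS0.le, hST⟩ hS0.le
    obtain ⟨h0, h1⟩ := interior_subset ht
    rw [(hder _ t h0 h1).deriv, sub_sub_cancel_left]
    have hp := hpos t h0 h1
    have hk : 0 < (β - 1) * f t ^ (-β) := mul_pos (sub_pos.2 hβ) (Real.rpow_pos_of_pos hp _)
    have h2 : deriv f t ≤ -(c₂ * f t ^ β) := by
      linarith [hd t h0 hp, mul_pos hc₁ (Real.rpow_pos_of_pos hp α)]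
    linear_combination ((β - 1) * f t ^ (-β)) * h2 - c₂ * (β - 1) * hmul β t h0 h1
  have hsmall : f T ^ (1 - α) - f S ^ (1 - α) ≤ -(c₁ * (1 - α)) * (T - S) := by
    refine (convex_Icc 0 T).image_sub_le_mul_sub_of_deriv_le (f := fun s => f s ^ (1 - α))
      (fun t ht => (hder _ t ht.1 ht.2).continuousAt.continuousWithinAt)
      (fun t ht => (hder _ t (interior_subset ht).1
        (interior_subset ht).2).differentiableAt.differentiableWithinAt)
      (fun t ht => ?_) S ⟨hS0.le, hST⟩ T ⟨hS0.le.trans hST, le_rfl⟩ hST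
    obtain ⟨h0, h1⟩ := interior_subset ht
    rw [(hder _ t h0 h1).deriv, sub_sub_cancel_left]
    have hp := hpos t h0 h1
    have hk : 0 < (1 - α) * f t ^ (-α) := mul_pos (sub_pos.2 hα) (Real.rpow_pos_of_pos hp _)
    have h2 : deriv f t ≤ -(c₁ * f t ^ α) := by
      linarith [hd t h0 hp, mul_pos hc₂ (Real.rpow_pos_of_pos hp β)]
    linear_combination ((1 - α) * f t ^ (-α)) * h2 - c₁ * (1 - α) * hmul α t h0 h1
  have hfS : f S < 1 := by
    by_contra! h
    have h1 : f S ^ (1 - β) ≤ 1 := Real.rpow_le_one_of_one_le_of_nonpos h (by linarith)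
    have h2 := Real.rpow_pos_of_pos (hpos 0 le_rfl (hS0.le.trans hST)) (1 - β)
    have h3 : c₂ * (β - 1) * S = 1 := mul_one_div_cancel hβ'.ne'
    linarith
  have hfS' : f S ^ (1 - α) < 1 := Real.rpow_lt_one (hnn S) hfS (sub_pos.2 hα)
  have hTS : 1 ≤ c₁ * (1 - α) * (T - S) := by
    rw [← div_le_iff₀' hα']
    linarith
  linarith [Real.rpow_nonneg (hnn T) (1 - α)]

/-- HGD with the fixed-time law selector `σ(V,t) = c₁ V^α + c₂ V^β`,
`0 < α < 1 < β`: the feedback `ż = -(σ(V(z),t)/‖∇V(z)‖²) ∇V(z)` (required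
wherever `V(z(t)) > 0`, with the nonsingularity condition there) drives `V` to
zero within the uniform time bound `1/(c₁(1-α)) + 1/(c₂(β-1))`, independent of
the initial condition `z(0)`. -/
theorem hgd_fixed_time_law
    (n : ℕ) (V : EuclideanSpace ℝ (Fin n) → ℝ) (hV : ContDiff ℝ 1 V)
    (hnn : ∀ y, 0 ≤ V y)
    (c₁ c₂ α β : ℝ) (hc₁ : 0 < c₁) (hc₂ : 0 < c₂)
    (hα0 : 0 < α) (hα1 : α < 1) (hβ : 1 < β)
    (z : ℝ → EuclideanSpace ℝ (Fin n)) (hz : Differentiable ℝ z)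
    (hgrad : ∀ t, 0 ≤ t → 0 < V (z t) → gradient V (z t) ≠ 0)
    (hdyn : ∀ t, 0 ≤ t → 0 < V (z t) → deriv z t =
      (-((c₁ * V (z t) ^ α + c₂ * V (z t) ^ β) / ‖gradient V (z t)‖ ^ 2)) •
        gradient V (z t)) :
    ∀ t, 1 / (c₁ * (1 - α)) + 1 / (c₂ * (β - 1)) ≤ t → V (z t) = 0 := by
  have hVd : ∀ y, DifferentiableAt ℝ V y := hV.differentiable one_ne_zero
  intro T hT
  refine eq_zero_of_deriv_le_fixed_time (f := fun t => V (z t))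
    (fun t => (hVd (z t)).comp t (hz t)) (fun t => hnn (z t)) hc₁ hc₂ hα1 hβ
    (fun t ht hpos => le_of_eq ?_) hT
  have hchain : HasDerivAt (fun t => V (z t)) (inner ℝ (gradient V (z t)) (deriv z t)) t := by
    simpa [Function.comp_def] using
      (hVd (z t)).hasGradientAt.hasFDerivAt.comp_hasDerivAt t (hz t).hasDerivAt
  have hg : ‖gradient V (z t)‖ ^ 2 ≠ 0 := pow_ne_zero 2 (norm_ne_zero_iff.2 (hgrad t ht hpos))
  rw [hchain.deriv, hdyn t ht hpos, real_inner_smul_right, real_inner_self_eq_norm_sq, neg_mul,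
    div_mul_cancel₀ _ hg]
end

section
/- Let V : ℝⁿ → ℝ be continuously differentiable and nonnegative, let T > 0 and μ > 0, and let z : [0,T) → ℝⁿ be a differentiable trajectory such that for every t ∈ [0,T), ∇V(z(t)) ≠ 0 and z'(t) = -((μ/(T-t)) · V(z(t)) / ‖∇V(z(t))‖²) · ∇V(z(t)). Then V(z(t)) = V(z(0)) · ((T-t)/T)^{μ} for all t ∈ [0,T); in particular V(z(t)) → 0 as t → T⁻, independently of the initial condition z(0). -/
theorem HasGradientAt.comp_hasDerivAt_inner {E : Type*} [NormedAddCommGroup E]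
    [InnerProductSpace ℝ E] [CompleteSpace E] {V : E → ℝ} {g v : E} {z : ℝ → E} {t : ℝ}
    (hV : HasGradientAt V g (z t)) (hz : HasDerivAt z v t) :
    HasDerivAt (fun s => V (z s)) (inner ℝ g v) t := by
  exact (hV.hasFDerivAt.comp_hasDerivAt t hz).congr_deriv (by simp)

/-- Solutions of `w' = -(μ/(T-t)) w` on `[0,T)` are multiples of `((T-t)/T)^μ`. -/
theorem eq_mul_rpow_of_hasDerivAt_prescribed_time {w : ℝ → ℝ} {T μ : ℝ}
    (hw : ∀ t, 0 ≤ t → t < T → HasDerivAt w (-(μ / (T - t)) * w t) t)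
    {t : ℝ} (h0 : 0 ≤ t) (ht : t < T) : w t = w 0 * ((T - t) / T) ^ μ := by
  have hT : 0 < T := h0.trans_lt ht
  have key : ∀ s ∈ Set.Icc 0 t, HasDerivAt (fun s => w s * (T - s) ^ (-μ)) 0 s := by
    intro s hs
    have hpos : 0 < T - s := sub_pos.2 (hs.2.trans_lt ht)
    have hp := ((hasDerivAt_id s).const_sub T).rpow_const (p := -μ) (Or.inl hpos.ne')
    refine ((hw s hs.1 (hs.2.trans_lt ht)).mul hp).congr_deriv ?_
    simp only [id]
    rw [Real.rpow_sub_one hpos.ne']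
    field_simp
    ring
  have hconst := constant_of_has_deriv_right_zero
    (fun s hs => (key s hs).continuousAt.continuousWithinAt)
    (fun s hs => (key s (Set.Ico_subset_Icc_self hs)).hasDerivWithinAt) t ⟨h0, le_rfl⟩
  have hpos : 0 < T - t := sub_pos.2 ht
  simp only [sub_zero, Real.rpow_neg hpos.le, Real.rpow_neg hT.le] at hconst
  rw [Real.div_rpow hpos.le hT.le]
  have h1 := (Real.rpow_pos_of_pos hpos μ).ne'
  have h2 := (Real.rpow_pos_of_pos hT μ).ne'
  field_simp at hconst ⊢
  linarith

/-- HGD with the prescribed-time law selector `σ(V,t) = (μ/(T-t)) V` on `[0,T)`: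
the feedback `ż = -((μ/(T-t)) V(z)/‖∇V(z)‖²) ∇V(z)` under the nonsingularity
condition yields `V(z(t)) = V(z(0)) ((T-t)/T)^μ` on `[0,T)`; in particular
`V(z(t)) → 0` as `t → T⁻`, independently of the initial condition. -/
theorem hgd_prescribed_time_law
    (n : ℕ) (V : EuclideanSpace ℝ (Fin n) → ℝ) (hV : ContDiff ℝ 1 V)
    (hnn : ∀ y, 0 ≤ V y)
    (T μ : ℝ) (hT : 0 < T) (hμ : 0 < μ)
    (z : ℝ → EuclideanSpace ℝ (Fin n))
    (hz : ∀ t, 0 ≤ t → t < T → DifferentiableAt ℝ z t)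
    (hgrad : ∀ t, 0 ≤ t → t < T → gradient V (z t) ≠ 0)
    (hdyn : ∀ t, 0 ≤ t → t < T → deriv z t =
      (-((μ / (T - t)) * V (z t) / ‖gradient V (z t)‖ ^ 2)) • gradient V (z t)) :
    (∀ t, 0 ≤ t → t < T → V (z t) = V (z 0) * ((T - t) / T) ^ μ) ∧
      Filter.Tendsto (fun t => V (z t)) (nhdsWithin T (Set.Iio T)) (nhds 0) := by
  have hsol : ∀ t, 0 ≤ t → t < T → V (z t) = V (z 0) * ((T - t) / T) ^ μ := by
    intro t h0 ht
    refine eq_mul_rpow_of_hasDerivAt_prescribed_time (w := fun s => V (z s)) ?_ h0 ht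
    intro s hs0 hs
    have hg := ((hV.differentiable one_ne_zero) (z s)).hasGradientAt
    refine (hg.comp_hasDerivAt_inner (hz s hs0 hs).hasDerivAt).congr_deriv ?_
    have hne : ‖gradient V (z s)‖ ≠ 0 := norm_ne_zero_iff.2 (hgrad s hs0 hs)
    rw [hdyn s hs0 hs, real_inner_smul_right, real_inner_self_eq_norm_sq, neg_mul, neg_mul,
      div_mul_cancel₀ _ (pow_ne_zero 2 hne)]
  refine ⟨hsol, ?_⟩
  have hcont : Continuous fun t => V (z 0) * ((T - t) / T) ^ μ :=
    continuous_const.mul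
      (((continuous_const.sub continuous_id).div_const T).rpow_const fun _ => Or.inr hμ.le)
  have hlim : Filter.Tendsto (fun t => V (z 0) * ((T - t) / T) ^ μ)
      (nhdsWithin T (Set.Iio T)) (nhds 0) := by
    have h := hcont.tendsto T
    simp only [sub_self, zero_div, Real.zero_rpow hμ.ne', mul_zero] at h
    exact h.mono_left nhdsWithin_le_nhds
  refine hlim.congr' ?_
  filter_upwards [Ico_mem_nhdsLT hT] with t ht
  exact (hsol t ht.1 ht.2).symm
end
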